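/- arXiv:2106.09425 — 2 statements merged into one kernel-verified Lean document; each statement's English description precedes it below -/
import Mathlib

section
/- Let l be a list of transpositions of Fin n such that N(l.prod) < l.length. Then l is connected by standard moves to a list whose first two entries are equal, i.e. to a list of the form τ :: τ :: t for some transposition τ and some list t. (The geodesic PMQ S_n^geo is pairwise determined.) -/
/-- Word-length norm of a permutation with respect to the set of all transpositions:
the least `m` such that `σ` is a product of `m` transpositions. -/
noncomputable def permNorm {n : ℕ} (σ : Equiv.Perm (Fin n)) : ℕ :=
  sInf {m | ∃ l : List (Equiv.Perm (Fin n)), (∀ τ ∈ l, τ.IsSwap) ∧ l.prod = σ ∧ l.length = m}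

/-- A single standard move on a list of elements of a group: an adjacent pair `(a, b)`
is replaced by `(b, b⁻¹ * a * b)` or by `(a * b * a⁻¹, a)`. -/
def StandardMove {G : Type*} [Group G] (l l' : List G) : Prop :=
  ∃ (l₁ l₂ : List G) (a b : G),
    l = l₁ ++ a :: b :: l₂ ∧
    (l' = l₁ ++ b :: (b⁻¹ * a * b) :: l₂ ∨ l' = l₁ ++ (a * b * a⁻¹) :: a :: l₂)

/-- Two lists are connected by standard moves. -/
def StdConnected {G : Type*} [Group G] : List G → List G → Prop :=
  Relation.ReflTransGen StandardMove

open Equiv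

section Moves

variable {G : Type*} [Group G] {l l' : List G}

theorem StandardMove.cons (c : G) (h : StandardMove l l') :
    StandardMove (c :: l) (c :: l') := by
  obtain ⟨l₁, l₂, a, b, rfl, rfl | rfl⟩ := h
  · exact ⟨c :: l₁, l₂, a, b, rfl, Or.inl rfl⟩
  · exact ⟨c :: l₁, l₂, a, b, rfl, Or.inr rfl⟩

theorem StdConnected.cons (c : G) (h : StdConnected l l') :
    StdConnected (c :: l) (c :: l') := by
  induction h with
  | refl => exact .refl
  | tail _ h ih => exact ih.tail (h.cons c)

theorem stdConnected_conj_right (a b : G) (t : List G) :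
    StdConnected (a :: b :: t) (b :: (b⁻¹ * a * b) :: t) :=
  .single ⟨[], t, a, b, rfl, Or.inl rfl⟩

theorem stdConnected_conj_left (a b : G) (t : List G) :
    StdConnected (a :: b :: t) ((a * b * a⁻¹) :: a :: t) :=
  .single ⟨[], t, a, b, rfl, Or.inr rfl⟩

theorem StdConnected.length_eq (h : StdConnected l l') : l'.length = l.length := by
  induction h with
  | refl => rfl
  | tail _ h ih =>
    obtain ⟨l₁, l₂, a, b, rfl, rfl | rfl⟩ := h <;> simpa using ih

theorem StandardMove.symm (h : StandardMove l l') : StandardMove l' l := by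
  obtain ⟨l₁, l₂, a, b, rfl, rfl | rfl⟩ := h
  · exact ⟨l₁, l₂, b, b⁻¹ * a * b, rfl, Or.inr (by simp [mul_assoc])⟩
  · exact ⟨l₁, l₂, a * b * a⁻¹, a, rfl, Or.inl (by simp [mul_assoc])⟩

theorem StdConnected.symm (h : StdConnected l l') : StdConnected l' l := by
  induction h with
  | refl => exact .refl
  | tail _ h ih => exact ih.head h.symm

theorem StandardMove.le_closure (h : StandardMove l l') :
    Subgroup.closure {g | g ∈ l} ≤ Subgroup.closure {g | g ∈ l'} := by
  rw [Subgroup.closure_le]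
  obtain ⟨l₁, l₂, a, b, rfl, rfl | rfl⟩ := h
  · set K := Subgroup.closure {g | g ∈ l₁ ++ b :: (b⁻¹ * a * b) :: l₂}
    have hsub : ∀ g ∈ l₁ ++ b :: (b⁻¹ * a * b) :: l₂, g ∈ K :=
      fun g hg => Subgroup.subset_closure hg
    have hb : b ∈ K := hsub b (by simp)
    have ha : a ∈ K := by
      have := K.mul_mem (K.mul_mem hb (hsub (b⁻¹ * a * b) (by simp))) (K.inv_mem hb)
      simpa [mul_assoc] using this
    intro g hg
    simp only [Set.mem_ofPred_eq, List.mem_append, List.mem_cons] at hg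
    rcases hg with hg | rfl | rfl | hg
    · exact hsub g (by simp [hg])
    · exact ha
    · exact hb
    · exact hsub g (by simp [hg])
  · set K := Subgroup.closure {g | g ∈ l₁ ++ (a * b * a⁻¹) :: a :: l₂}
    have hsub : ∀ g ∈ l₁ ++ (a * b * a⁻¹) :: a :: l₂, g ∈ K :=
      fun g hg => Subgroup.subset_closure hg
    have ha : a ∈ K := hsub a (by simp)
    have hb : b ∈ K := by
      have := K.mul_mem (K.mul_mem (K.inv_mem ha) (hsub (a * b * a⁻¹) (by simp))) ha
      simpa [mul_assoc] using this
    intro g hg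
    simp only [Set.mem_ofPred_eq, List.mem_append, List.mem_cons] at hg
    rcases hg with hg | rfl | rfl | hg
    · exact hsub g (by simp [hg])
    · exact ha
    · exact hb
    · exact hsub g (by simp [hg])

theorem StdConnected.le_closure (h : StdConnected l l') :
    Subgroup.closure {g | g ∈ l} ≤ Subgroup.closure {g | g ∈ l'} := by
  induction h with
  | refl => exact le_rfl
  | tail _ h ih => exact ih.trans h.le_closure

end Moves

section Transpositions

variable {α : Type*} [DecidableEq α]

theorem Equiv.Perm.IsSwap.conj {σ : Perm α} (h : σ.IsSwap) (g : Perm α) :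
    (g * σ * g⁻¹).IsSwap := by
  obtain ⟨x, y, hxy, rfl⟩ := h
  exact ⟨g x, g y, by simpa using hxy, (swap_apply_apply g x y).symm⟩

theorem StdConnected.isSwap {l l' : List (Perm α)} (h : StdConnected l l')
    (hl : ∀ τ ∈ l, τ.IsSwap) : ∀ τ ∈ l', τ.IsSwap := by
  induction h with
  | refl => exact hl
  | tail _ h ih =>
    obtain ⟨l₁, l₂, a, b, rfl, rfl | rfl⟩ := h
    · have := (ih a (by simp)).conj b⁻¹
      rw [inv_inv] at this
      grind
    · have := (ih b (by simp)).conj a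
      grind

theorem swap_conj_of_ne {x y z : α} (hxz : x ≠ z) (hyz : y ≠ z) :
    swap x y * swap y z * (swap x y)⁻¹ = swap x z := by
  rw [← swap_apply_apply, swap_apply_right, swap_apply_of_ne_of_ne hxz.symm hyz.symm]

end Transpositions

section Linked

/-- Two points are linked by a list of permutations if they lie in the same orbit of the
subgroup which the list generates. -/
def Linked {α : Type*} (l : List (Perm α)) (x y : α) : Prop :=
  ∃ g ∈ Subgroup.closure {g | g ∈ l}, g x = y

variable {α : Type*} {l l' : List (Perm α)} {x y z u v : α}

theorem Linked.refl (l : List (Perm α)) (x : α) : Linked l x x :=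
  ⟨1, one_mem _, rfl⟩

theorem Linked.symm (h : Linked l x y) : Linked l y x := by
  obtain ⟨g, hg, rfl⟩ := h
  exact ⟨g⁻¹, inv_mem hg, by simp⟩

theorem Linked.trans (h : Linked l x y) (h' : Linked l y z) : Linked l x z := by
  obtain ⟨g, hg, rfl⟩ := h
  obtain ⟨k, hk, rfl⟩ := h'
  exact ⟨k * g, mul_mem hk hg, rfl⟩

theorem Linked.cons (σ : Perm α) (h : Linked l x y) : Linked (σ :: l) x y := by
  obtain ⟨g, hg, rfl⟩ := h
  exact ⟨g, Subgroup.closure_mono (fun _ h => List.mem_cons_of_mem _ h) hg, rfl⟩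

theorem Linked.of_stdConnected (h : StdConnected l l') (hl : Linked l x y) : Linked l' x y := by
  obtain ⟨g, hg, rfl⟩ := hl
  exact ⟨g, h.le_closure hg, rfl⟩

theorem Equiv.Perm.SameCycle.linked (h : l.prod.SameCycle x y) : Linked l x y := by
  obtain ⟨i, rfl⟩ := h
  exact ⟨_, zpow_mem (list_prod_mem fun _ h => Subgroup.subset_closure h) i, Eq.refl _⟩

theorem Linked.of_swap_cons [DecidableEq α] (h : Linked (swap u v :: l) x y) :
    Linked l x y ∨ (Linked l x u ∧ Linked l v y) ∨ (Linked l x v ∧ Linked l u y) := by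
  obtain ⟨g, hg, rfl⟩ := h
  induction hg using Subgroup.closure_induction generalizing x with
  | mem g hg =>
    rcases List.mem_cons.1 hg with rfl | hg
    · by_cases hu : x = u
      · subst hu
        exact Or.inr (Or.inl ⟨.refl _ _, by simpa using Linked.refl l v⟩)
      by_cases hv : x = v
      · subst hv
        exact Or.inr (Or.inr ⟨.refl _ _, by simpa using Linked.refl l u⟩)
      rw [swap_apply_of_ne_of_ne hu hv]
      exact Or.inl (.refl _ _)
    · exact Or.inl ⟨g, Subgroup.subset_closure hg, rfl⟩
  | one => exact Or.inl (.refl _ _)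
  | mul g k _ _ ihg ihk =>
    have h₁ := ihk (x := x)
    have h₂ := ihg (x := k x)
    rw [Perm.mul_apply]
    grind [Linked.trans, Linked.symm]
  | inv g _ ih =>
    have := ih (x := g⁻¹ x)
    rw [show g (g⁻¹ x) = x by simp] at this
    grind [Linked.symm]

theorem Linked.exists_stdConnected_swap_cons [DecidableEq α] (hl : ∀ τ ∈ l, τ.IsSwap)
    (hxy : x ≠ y) (h : Linked l x y) : ∃ t, StdConnected l (swap x y :: t) := by
  induction hk : l.length generalizing l x y with
  | zero =>
    obtain rfl := List.length_eq_zero_iff.1 hk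
    obtain ⟨g, hg, rfl⟩ := h
    simp at hg
    simp [hg] at hxy
  | succ k ih =>
    obtain _ | ⟨b, l⟩ := l
    · simp at hk
    have hlen : l.length = k := by simpa using hk
    have hl' : ∀ τ ∈ l, τ.IsSwap := fun τ h => hl τ (List.mem_cons_of_mem _ h)
    by_cases hnot : Linked l x y
    · obtain ⟨t, ht⟩ := ih hl' hxy hnot hlen
      exact ⟨_, (ht.cons b).trans (stdConnected_conj_right _ _ _)⟩
    have main : ∀ u v, u ≠ v → b = swap u v → Linked l x u → Linked l v y →
        ∃ t, StdConnected (b :: l) (swap x y :: t) := by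
      rintro u v huv rfl hxu hvy
      have hxv : x ≠ v := fun h => hnot (h ▸ hvy)
      obtain ⟨t, ht, htv⟩ : ∃ t, StdConnected (swap u v :: l) (swap x v :: t) ∧
          Linked t v y := by
        by_cases hxu' : x = u
        · subst hxu'
          exact ⟨l, .refl, hvy⟩
        obtain ⟨t, ht⟩ := ih hl' hxu' hxu hlen
        refine ⟨swap u v :: t, ?_, ?_⟩
        · have := stdConnected_conj_left (swap v u) (swap u x) t
          rw [swap_conj_of_ne hxv.symm (Ne.symm hxu'), swap_comm v u, swap_comm u x,
            swap_comm v x] at this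
          exact (ht.cons _).trans this
        · refine Linked.cons _ ?_
          have hsub : ∀ {p q}, Linked t p q → Linked l p q :=
            fun h => (h.cons _).of_stdConnected ht.symm
          rcases (hvy.of_stdConnected ht).of_swap_cons with h | ⟨h, -⟩ | ⟨-, h⟩
          · exact h
          · exact absurd ((hsub h).symm.trans hvy) hnot
          · exact absurd (hsub h) hnot
      have htl : t.length = k := by
        have := ht.length_eq
        simp at this
        omega
      by_cases hvy' : v = y
      · subst hvy'
        exact ⟨t, ht⟩
      obtain ⟨t', ht'⟩ := ih (fun τ h => ht.isSwap hl τ (List.mem_cons_of_mem _ h)) hvy' htv htl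
      have := stdConnected_conj_left (swap x v) (swap v y) t'
      rw [swap_conj_of_ne hxy hvy'] at this
      exact ⟨_, (ht.trans (ht'.cons _)).trans this⟩
    obtain ⟨u, v, huv, rfl⟩ := hl b (by simp)
    rcases h.of_swap_cons with h | ⟨h, h'⟩ | ⟨h, h'⟩
    · exact absurd h hnot
    · exact main u v huv rfl h h'
    · exact main v u huv.symm (swap_comm u v) h h'

end Linked

section Invariants

variable {α : Type*}

/-- The space of rational functions invariant under a permutation; its dimension is the number
of cycles, fixed points included. -/
def invariantFunctions (σ : Perm α) : Submodule ℚ (α → ℚ) where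
  carrier := {f | ∀ w, f (σ w) = f w}
  add_mem' hf hg w := by simp [hf w, hg w]
  zero_mem' w := rfl
  smul_mem' c f hf w := by simp [hf w]

theorem mem_invariantFunctions {σ : Perm α} {f : α → ℚ} :
    f ∈ invariantFunctions σ ↔ ∀ w, f (σ w) = f w :=
  Iff.rfl

theorem apply_swap_of_eq [DecidableEq α] {β : Type*} {f : α → β} {x y : α} (h : f x = f y)
    (w : α) : f (swap x y w) = f w := by
  rw [swap_apply_def]
  grind

variable [Fintype α] [DecidableEq α]

theorem finrank_invariantFunctions_le (σ : Perm α) (x y : α) :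
    Module.finrank ℚ (invariantFunctions σ) ≤
      Module.finrank ℚ (invariantFunctions (swap x y * σ)) + 1 := by
  set φ : (α → ℚ) →ₗ[ℚ] ℚ := LinearMap.proj (R := ℚ) (φ := fun _ => ℚ) x - LinearMap.proj y
  have hle : invariantFunctions σ ⊓ LinearMap.ker φ ≤ invariantFunctions (swap x y * σ) := by
    rintro f ⟨hf, hφ⟩ w
    have hxy : f x = f y := sub_eq_zero.1 hφ
    rw [Perm.mul_apply, apply_swap_of_eq hxy]
    exact hf w
  have h₁ := Submodule.finrank_mono hle
  have h₂ := Submodule.finrank_sup_add_finrank_inf_eq (invariantFunctions σ) (LinearMap.ker φ)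
  have h₃ := LinearMap.finrank_range_add_finrank_ker φ
  have h₄ := Submodule.finrank_le (LinearMap.range φ)
  have h₅ := Submodule.finrank_le (invariantFunctions σ ⊔ LinearMap.ker φ)
  rw [Module.finrank_self] at h₄
  omega

theorem card_le_finrank_invariantFunctions_add_length {l : List (Perm α)}
    (hl : ∀ τ ∈ l, τ.IsSwap) :
    Fintype.card α ≤ Module.finrank ℚ (invariantFunctions l.prod) + l.length := by
  induction l with
  | nil =>
    have : invariantFunctions (1 : Perm α) = ⊤ := by
      ext f
      simp [mem_invariantFunctions]
    rw [List.prod_nil, this]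
    simp
  | cons a l ih =>
    obtain ⟨x, y, -, rfl⟩ := hl a (by simp)
    have h₁ := ih fun τ h => hl τ (List.mem_cons_of_mem _ h)
    have h₂ := finrank_invariantFunctions_le l.prod x y
    rw [List.prod_cons, List.length_cons]
    omega

theorem apply_eq_of_mem_invariantFunctions_swap_mul {σ : Perm α} {x y : α}
    (hxy : ¬ σ.SameCycle x y) {f : α → ℚ} (hf : f ∈ invariantFunctions (swap x y * σ)) :
    f x = f y := by
  set m := Function.minimalPeriod σ x
  have hm : 0 < m := Function.minimalPeriod_pos_of_mem_periodicPts
    (σ.injective.mem_periodicPts x)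
  have hy : ∀ i, σ^[i] x ≠ y := fun i h => hxy ⟨i, by simpa [Perm.iterate_eq_pow] using h⟩
  have key : ∀ i < m, f (σ^[i] x) = f x := by
    intro i hi
    induction i with
    | zero => rfl
    | succ i ih =>
      rw [← ih (by omega), ← hf (σ^[i] x), Perm.mul_apply, ← Function.iterate_succ_apply' (f := σ),
        swap_apply_of_ne_of_ne _ (hy _)]
      exact Function.not_isPeriodicPt_of_pos_of_lt_minimalPeriod (by omega) hi
  obtain ⟨p, hp⟩ : ∃ p, m = p + 1 := ⟨m - 1, by omega⟩
  have hlast : σ (σ^[p] x) = x := by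
    rw [← Function.iterate_succ_apply' (f := σ), Nat.succ_eq_add_one, ← hp]
    exact Function.iterate_minimalPeriod
  have := hf (σ^[p] x)
  rw [Perm.mul_apply, hlast, swap_apply_left, key p (by omega)] at this
  exact this.symm

theorem finrank_invariantFunctions_swap_mul_lt {σ : Perm α} {x y : α}
    (hxy : ¬ σ.SameCycle x y) :
    Module.finrank ℚ (invariantFunctions (swap x y * σ)) <
      Module.finrank ℚ (invariantFunctions σ) := by
  refine Submodule.finrank_lt_finrank_of_lt (lt_of_le_of_ne (fun f hf w => ?_) fun h => ?_)
  · rw [← hf w, Perm.mul_apply,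
      apply_swap_of_eq (apply_eq_of_mem_invariantFunctions_swap_mul hxy hf)]
  · have hg : (fun w => if σ.SameCycle x w then (1 : ℚ) else 0) ∈ invariantFunctions σ :=
      fun w => by simp only [Perm.sameCycle_apply_right]
    rw [← h] at hg
    have := apply_eq_of_mem_invariantFunctions_swap_mul hxy hg
    simp [hxy, Perm.SameCycle.refl] at this

end Invariants

theorem exists_stdConnected_repeated_head_or_finrank_add_length_le {α : Type*} [Fintype α]
    [DecidableEq α] {l : List (Perm α)} (hl : ∀ τ ∈ l, τ.IsSwap) :
    (∃ (τ : Perm α) (t : List (Perm α)), τ.IsSwap ∧ StdConnected l (τ :: τ :: t)) ∨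
      Module.finrank ℚ (invariantFunctions l.prod) + l.length ≤ Fintype.card α := by
  induction l with
  | nil =>
    right
    rw [← Module.finrank_fintype_fun_eq_card ℚ]
    exact Submodule.finrank_le _
  | cons a l ih =>
    have hl' : ∀ τ ∈ l, τ.IsSwap := fun τ h => hl τ (List.mem_cons_of_mem _ h)
    rcases ih hl' with ⟨τ, t, hτ, ht⟩ | h
    · left
      have h₁ := stdConnected_conj_right a τ (τ :: t)
      have h₂ := (stdConnected_conj_right (τ⁻¹ * a * τ) τ t).cons τ
      exact ⟨τ, _, hτ, ((ht.cons a).trans h₁).trans h₂⟩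
    · obtain ⟨x, y, hxy, rfl⟩ := hl a (by simp)
      by_cases hc : l.prod.SameCycle x y
      · left
        obtain ⟨t, ht⟩ := hc.linked.exists_stdConnected_swap_cons hl' hxy
        exact ⟨_, t, ⟨x, y, hxy, rfl⟩, ht.cons _⟩
      · right
        have := finrank_invariantFunctions_swap_mul_lt hc
        rw [List.prod_cons, List.length_cons]
        omega


/-- The geodesic PMQ `S_n^geo` is pairwise determined: a non-geodesic list of
transpositions is connected by standard moves to a list starting with two equal
transpositions. -/
theorem stdConnected_to_repeated_head_of_not_geodesic (n : ℕ)
    (l : List (Equiv.Perm (Fin n)))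
    (hswap : ∀ τ ∈ l, τ.IsSwap)
    (h : permNorm l.prod < l.length) :
    ∃ (τ : Equiv.Perm (Fin n)) (t : List (Equiv.Perm (Fin n))),
      τ.IsSwap ∧ StdConnected l (τ :: τ :: t) := by
  refine (exists_stdConnected_repeated_head_or_finrank_add_length_le hswap).resolve_right
    fun hle => ?_
  obtain ⟨m, hm, hprod, hlen⟩ := Nat.sInf_mem
    (s := {m | ∃ l' : List (Perm (Fin n)), (∀ τ ∈ l', τ.IsSwap) ∧ l'.prod = l.prod ∧
      l'.length = m}) ⟨_, l, hswap, rfl, rfl⟩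
  have := card_le_finrank_invariantFunctions_add_length hm
  rw [permNorm, ← hlen] at h
  rw [hprod] at this
  omega
end

section
/- Let l be a list of transpositions of Fin n whose entries generate the full symmetric group of Fin n (Subgroup.closure of the set of entries equals ⊤), and let τ₀ be any transposition of Fin n. Then l is connected by standard moves to a list whose last entry is τ₀, i.e. to a list of the form l′ ++ [τ₀]. -/
namespace StdConnected

variable {G : Type*} [Group G]

theorem append_left (u : List G) {l l' : List G} (h : StdConnected l l') :
    StdConnected (u ++ l) (u ++ l') := by
  refine Relation.ReflTransGen.lift (u ++ ·) ?_ _ _ h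
  rintro _ _ ⟨l₁, l₂, a, b, rfl, rfl | rfl⟩
  · exact ⟨u ++ l₁, l₂, a, b, by simp, Or.inl (by simp)⟩
  · exact ⟨u ++ l₁, l₂, a, b, by simp, Or.inr (by simp)⟩

theorem cons_cons_left (a b : G) (l : List G) :
    StdConnected (a :: b :: l) ((a * b * a⁻¹) :: a :: l) :=
  .single ⟨[], l, a, b, rfl, Or.inr rfl⟩

theorem cons_cons_right (a b : G) (l : List G) :
    StdConnected (a :: b :: l) (b :: (b⁻¹ * a * b) :: l) :=
  .single ⟨[], l, a, b, rfl, Or.inl rfl⟩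

/-- An entry can be moved to the right unchanged, conjugating the entries it passes. -/
theorem move_right (g : G) (v w : List G) :
    StdConnected (g :: (v ++ w)) (v.map (fun b => g * b * g⁻¹) ++ g :: w) := by
  induction v with
  | nil => exact .refl
  | cons b v ih => exact (cons_cons_left g b (v ++ w)).trans (ih.append_left [g * b * g⁻¹])

/-- An entry can be moved to the left unchanged, conjugating the entries it passes. -/
theorem move_left (g : G) (v w : List G) :
    StdConnected (v ++ g :: w) (g :: (v.map (fun b => g⁻¹ * b * g) ++ w)) := by
  induction v with
  | nil => exact .refl
  | cons b v ih => exact (ih.append_left [b]).trans (cons_cons_right b g _)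

theorem exists_concat_of_mem {g : G} {l : List G} (hg : g ∈ l) :
    ∃ l', StdConnected l (l' ++ [g]) := by
  obtain ⟨u, v, rfl⟩ := List.append_of_mem hg
  refine ⟨u ++ v.map (fun b => g * b * g⁻¹), ?_⟩
  simpa using (move_right g v []).append_left u

/-- Some conjugate of the entry `f` by another entry `e` can be created, keeping all other
entries that commute with `e`. -/
theorem exists_conj_mem {e f : G} {l : List G} (he : e ∈ l) (hf : f ∈ l) (hne : e ≠ f) :
    ∃ l', StdConnected l l' ∧ (e * f * e⁻¹ ∈ l' ∨ e⁻¹ * f * e ∈ l') ∧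
      ∀ c ∈ l, c ≠ e → c ≠ f → Commute e c → c ∈ l' := by
  obtain ⟨u, v, rfl⟩ := List.append_of_mem he
  have hf' : f ∈ u ∨ f ∈ v := by simpa [hne.symm] using hf
  rcases hf' with hf' | hf'
  · obtain ⟨s, t, rfl⟩ := List.append_of_mem hf'
    refine ⟨s ++ (e :: (e⁻¹ * f * e) :: (t.map (fun b => e⁻¹ * b * e) ++ v)), ?_, by simp, ?_⟩
    · simpa using append_left s
        (((move_left e t v).append_left [f]).trans (cons_cons_right f e _))
    · intro c hc hce hcf hcomm
      have hfix : e⁻¹ * c * e = c := by rw [mul_assoc, ← hcomm.eq, inv_mul_cancel_left]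
      have hc' : c ∈ s ∨ c ∈ t ∨ c ∈ v := by simpa [hce, hcf, or_assoc] using hc
      rcases hc' with h | h | h
      · simp [h]
      · have := List.mem_map_of_mem (f := fun b => e⁻¹ * b * e) h
        simp only [hfix] at this
        exact List.mem_append_right _ (.tail _ (.tail _ (List.mem_append_left _ this)))
      · simp [h]
  · obtain ⟨s, t, rfl⟩ := List.append_of_mem hf'
    refine ⟨u ++ (s.map (fun b => e * b * e⁻¹) ++ (e * f * e⁻¹) :: e :: t), ?_, by simp, ?_⟩
    · exact append_left u
        ((move_right e s (f :: t)).trans ((cons_cons_left e f t).append_left _))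
    · intro c hc hce hcf hcomm
      have hfix : e * c * e⁻¹ = c := by rw [hcomm.eq, mul_inv_cancel_right]
      have hc' : c ∈ u ∨ c ∈ s ∨ c ∈ t := by simpa [hce, hcf] using hc
      rcases hc' with h | h | h
      · simp [h]
      · have := List.mem_map_of_mem (f := fun b => e * b * e⁻¹) h
        simp only [hfix] at this
        exact List.mem_append_right _ (List.mem_append_left _ this)
      · simp [h]

end StdConnected

section SwapGraph

variable {α : Type*} [DecidableEq α]

/-- The graph on `α` whose edges are the pairs `{x, y}` with `swap x y` in the list `l`. -/
def swapGraph (l : List (Equiv.Perm α)) : SimpleGraph α where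
  Adj x y := x ≠ y ∧ Equiv.swap x y ∈ l
  symm := ⟨fun x y h => ⟨h.1.symm, Equiv.swap_comm x y ▸ h.2⟩⟩
  loopless := ⟨fun _ h => h.1 rfl⟩

theorem swapGraph_reachable_apply {l : List (Equiv.Perm α)} (hswap : ∀ τ ∈ l, τ.IsSwap)
    {g : Equiv.Perm α} (hg : g ∈ Subgroup.closure {τ | τ ∈ l}) (x : α) :
    (swapGraph l).Reachable x (g x) := by
  induction hg using Subgroup.closure_induction generalizing x with
  | mem τ hτ =>
    obtain ⟨a, b, hab, rfl⟩ := hswap τ hτ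
    have hadj : (swapGraph l).Adj a b := ⟨hab, hτ⟩
    rcases eq_or_ne x a with rfl | hxa
    · simpa using hadj.reachable
    rcases eq_or_ne x b with rfl | hxb
    · simpa using hadj.symm.reachable
    · rw [Equiv.swap_apply_of_ne_of_ne hxa hxb]
  | one => rfl
  | mul g h _ _ ihg ihh => exact (ihh x).trans (ihg (h x))
  | inv g _ ih => simpa using (ih (g⁻¹ x)).symm

/-- If `x` and `y` are joined by a path in the graph of `l`, then `swap x y` can be created. -/
theorem exists_stdConnected_swap_mem_of_isPath (k : ℕ) :
    ∀ (l : List (Equiv.Perm α)) {x y : α} (p : (swapGraph l).Walk x y), p.IsPath →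
      p.length = k + 1 → ∃ l', StdConnected l l' ∧ Equiv.swap x y ∈ l' := by
  induction k with
  | zero =>
    intro l x y p _ hk
    exact ⟨l, .refl, (SimpleGraph.Walk.adj_of_length_eq_one hk).2⟩
  | succ k ih =>
    intro l x y p hp hk
    cases p with
    | nil => simp at hk
    | @cons _ v _ hxv p =>
    cases p with
    | nil => simp at hk
    | @cons _ w _ hvw q =>
    simp only [SimpleGraph.Walk.cons_isPath_iff, SimpleGraph.Walk.support_cons,
      List.mem_cons, not_or] at hp
    obtain ⟨⟨hq, hvq⟩, -, hxq⟩ := hp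
    have hxw : x ≠ w := fun h => hxq (h ▸ q.start_mem_support)
    have hne : Equiv.swap x v ≠ Equiv.swap v w := fun h => by
      have := congrArg (· x) h
      simp [Equiv.swap_apply_of_ne_of_ne hxv.1 hxw] at this
      exact hxv.1 this.symm
    obtain ⟨l', hl', hconj, hkeep⟩ := StdConnected.exists_conj_mem hxv.2 hvw.2 hne
    have hmem : Equiv.swap x w ∈ l' := by
      have : Equiv.swap x v * Equiv.swap v w * Equiv.swap x v = Equiv.swap x w := by
        rw [Equiv.swap_comm x v, Equiv.swap_comm v w, Equiv.swap_comm x w]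
        simpa [Equiv.swap_comm] using
          Equiv.swap_mul_swap_mul_swap hvw.1.symm hxw.symm
      simpa [this] using hconj
    have hedges : ∀ e ∈ q.edges, e ∈ (swapGraph l').edgeSet := by
      intro e he
      induction e with
      | _ a b =>
      have hab : (swapGraph l).Adj a b := q.adj_of_mem_edges he
      have ha := q.fst_mem_support_of_mem_edges he
      have hb := q.snd_mem_support_of_mem_edges he
      have hax : a ≠ x := fun h => hxq (h ▸ ha)
      have hbx : b ≠ x := fun h => hxq (h ▸ hb)
      have hav : a ≠ v := fun h => hvq (h ▸ ha)
      have hbv : b ≠ v := fun h => hvq (h ▸ hb)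
      have hfix : Equiv.swap a b v = v := Equiv.swap_apply_of_ne_of_ne hav.symm hbv.symm
      refine ⟨hab.1, hkeep _ hab.2 ?_ ?_ ?_⟩
      · intro h
        rw [h, Equiv.swap_apply_right] at hfix
        exact hxv.1 hfix
      · intro h
        rw [h, Equiv.swap_apply_left] at hfix
        exact hvw.1 hfix.symm
      · refine (Equiv.Perm.disjoint_iff_eq_or_eq.2 fun z => ?_).commute
        rcases eq_or_ne z x with rfl | hzx
        · exact .inr (Equiv.swap_apply_of_ne_of_ne hax.symm hbx.symm)
        rcases eq_or_ne z v with rfl | hzv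
        · exact .inr hfix
        · exact .inl (Equiv.swap_apply_of_ne_of_ne hzx hzv)
    have hadj : (swapGraph l').Adj x w := ⟨hxw, hmem⟩
    obtain ⟨l'', hl'', hmem'⟩ := ih l' (.cons hadj (q.transfer _ hedges))
      (by simpa [SimpleGraph.Walk.cons_isPath_iff] using ⟨hq.transfer hedges, hxq⟩)
      (by simpa using hk)
    exact ⟨l'', hl'.trans hl'', hmem'⟩

end SwapGraph

/-- A list of transpositions generating the full symmetric group is connected by
standard moves to a list ending with any prescribed transposition `τ₀`. -/
theorem stdConnected_to_list_ending_with_any_transposition (n : ℕ)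
    (l : List (Equiv.Perm (Fin n)))
    (hswap : ∀ τ ∈ l, τ.IsSwap)
    (hgen : Subgroup.closure {τ | τ ∈ l} = ⊤)
    (τ₀ : Equiv.Perm (Fin n)) (hτ₀ : τ₀.IsSwap) :
    ∃ l' : List (Equiv.Perm (Fin n)), StdConnected l (l' ++ [τ₀]) := by
  obtain ⟨x, y, hxy, rfl⟩ := hτ₀
  have hreach := swapGraph_reachable_apply hswap (g := Equiv.swap x y) (by simp [hgen]) x
  rw [Equiv.swap_apply_left] at hreach
  obtain ⟨p, hp⟩ := hreach.exists_isPath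
  obtain ⟨k, hk⟩ := Nat.exists_eq_succ_of_ne_zero
    (fun h => hxy (SimpleGraph.Walk.eq_of_length_eq_zero (p := p) h))
  obtain ⟨l', hl', hmem⟩ := exists_stdConnected_swap_mem_of_isPath k l p hp hk
  obtain ⟨l'', hl''⟩ := StdConnected.exists_concat_of_mem hmem
  exact ⟨l'', hl'.trans hl''⟩
end
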